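/- arXiv:1009.5797 — 2 statements merged into one kernel-verified Lean document; each statement's English description precedes it below -/
import Mathlib

section
/- For every integer p ≥ 1, every R ≥ 0 and every real t, the two-sided series Σ_{j∈ℤ} I_{p|j|}(R) e^{ijt} converges absolutely and equals (1/p) Σ_{s=1}^p exp( R cos((t+2πs)/p) ). -/
/-- Modified Bessel function of the first kind of integer order `n ≥ 0`. -/
noncomputable def besselIN (n : ℕ) (R : ℝ) : ℝ :=
  ∑' m : ℕ, (R / 2) ^ (2 * m + n) / (Nat.factorial m * Nat.factorial (m + n))

/-- Reindexing of pairs of naturals by their difference and their minimum. -/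
def intProdNatEquiv : ℤ × ℕ ≃ ℕ × ℕ where
  toFun x := (x.2 + x.1.toNat, x.2 + (-x.1).toNat)
  invFun y := ((y.1 : ℤ) - y.2, min y.1 y.2)
  left_inv := by
    rintro ⟨n, m⟩
    ext <;> simp only <;> omega
  right_inv := by
    rintro ⟨a, b⟩
    ext <;> simp only <;> omega

/-- The summand of the product of two exponential series, in the reindexed coordinates. -/
theorem exp_terms_intProdNatEquiv (R : ℝ) {w : ℂ} (hw : w ≠ 0) (n : ℤ) (m : ℕ) :
    ((R / 2 : ℂ) * w) ^ (intProdNatEquiv (n, m)).1 / (intProdNatEquiv (n, m)).1.factorial *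
      (((R / 2 : ℂ) * w⁻¹) ^ (intProdNatEquiv (n, m)).2 /
        (intProdNatEquiv (n, m)).2.factorial) =
    (((R / 2) ^ (2 * m + n.natAbs) / (Nat.factorial m * Nat.factorial (m + n.natAbs)) : ℝ) : ℂ) *
      w ^ n := by
  have hwm : w ^ m * (w⁻¹) ^ m = 1 := by rw [← mul_pow, mul_inv_cancel₀ hw, one_pow]
  obtain ⟨k, rfl | rfl⟩ := n.eq_nat_or_neg
  · simp only [intProdNatEquiv, Equiv.coe_fn_mk, Int.toNat_natCast, Int.toNat_neg_natCast,
      Int.natAbs_natCast, add_zero, zpow_natCast]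
    push_cast
    simp only [two_mul, mul_pow, pow_add]
    linear_combination ((R / 2 : ℂ) ^ m * (R / 2 : ℂ) ^ m * (R / 2 : ℂ) ^ k * w ^ k /
      (m.factorial * (m + k).factorial)) * hwm
  · simp only [intProdNatEquiv, Equiv.coe_fn_mk, Int.toNat_natCast, Int.toNat_neg_natCast,
      Int.natAbs_natCast, Int.natAbs_neg, neg_neg, add_zero, zpow_neg, zpow_natCast, ← inv_pow]
    push_cast
    simp only [two_mul, mul_pow, pow_add]
    linear_combination ((R / 2 : ℂ) ^ m * (R / 2 : ℂ) ^ m * (R / 2 : ℂ) ^ k * w⁻¹ ^ k /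
      (m.factorial * (m + k).factorial)) * hwm

/-- The product of the exponential series at `u` and at `v`, as a double series. -/
theorem hasSum_exp_mul_exp (u v : ℂ) :
    HasSum (fun x : ℕ × ℕ => u ^ x.1 / x.1.factorial * (v ^ x.2 / x.2.factorial))
      (Complex.exp (u + v)) := by
  have hexp (z : ℂ) : HasSum (fun n : ℕ => z ^ n / n.factorial) (Complex.exp z) := by
    rw [Complex.exp_eq_exp_ℂ]
    exact NormedSpace.expSeries_div_hasSum_exp z
  have hnorm (z : ℂ) : Summable (fun n : ℕ => ‖z ^ n / n.factorial‖) := by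
    simpa only [norm_div, norm_pow, Complex.norm_natCast] using
      Real.summable_pow_div_factorial ‖z‖
  rw [Complex.exp_add]
  rw [← (hexp u).tsum_eq, ← (hexp v).tsum_eq, tsum_mul_tsum_of_summable_norm (hnorm u) (hnorm v)]
  exact (summable_mul_of_summable_norm (hnorm u) (hnorm v)).hasSum

/-- The generating function of the modified Bessel functions of integer order. -/
theorem hasSum_besselIN_mul_zpow (R : ℝ) {w : ℂ} (hw : w ≠ 0) :
    HasSum (fun n : ℤ => (besselIN n.natAbs R : ℂ) * w ^ n)
      (Complex.exp (R / 2 * (w + w⁻¹))) := by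
  have hreindexed : HasSum (fun x : ℤ × ℕ => (((R / 2) ^ (2 * x.2 + x.1.natAbs) /
      (Nat.factorial x.2 * Nat.factorial (x.2 + x.1.natAbs)) : ℝ) : ℂ) * w ^ x.1)
      (Complex.exp (R / 2 * (w + w⁻¹))) := by
    have h := hasSum_exp_mul_exp (R / 2 * w) (R / 2 * w⁻¹)
    rw [← mul_add] at h
    rw [← intProdNatEquiv.hasSum_iff] at h
    convert h using 1
    ext ⟨n, m⟩
    rw [Function.comp_apply, exp_terms_intProdNatEquiv R hw]
  have hfiber := hreindexed.prod_fiberwise fun n => (hreindexed.summable.prod_factor n).hasSum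
  simpa only [tsum_mul_right, ← Complex.ofReal_tsum, besselIN] using hfiber

/-- The Jacobi–Anger expansion of `exp (R cos θ)`. -/
theorem hasSum_besselIN_mul_exp (R θ : ℝ) :
    HasSum (fun n : ℤ => (besselIN n.natAbs R : ℂ) * Complex.exp (Complex.I * n * θ))
      (Real.exp (R * Real.cos θ)) := by
  convert! hasSum_besselIN_mul_zpow R (Complex.exp_ne_zero (θ * Complex.I)) using 1
  · ext n
    rw [← Complex.exp_int_mul]
    ring_nf
  · rw [← Complex.exp_neg]
    push_cast
    rw [Complex.cos]
    ring_nf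

/-- Averaging the `n`-th character over the `p` points `(t + 2πs) / p` kills it unless `p ∣ n`. -/
theorem sum_exp_eq_zero_of_not_dvd {p : ℕ} (hp : p ≠ 0) (t : ℝ) {n : ℤ} (hn : ¬ (p : ℤ) ∣ n) :
    ∑ s ∈ Finset.Icc 1 p,
      Complex.exp (Complex.I * n * ((t + 2 * Real.pi * s) / p : ℝ)) = 0 := by
  have hpc : (p : ℂ) ≠ 0 := by exact_mod_cast hp
  set ζ := Complex.exp (2 * Real.pi * Complex.I * n / p) with hζ
  have hζp : ζ ^ p = 1 := by
    rw [hζ, ← Complex.exp_nat_mul, Complex.exp_eq_one_iff]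
    exact ⟨n, by field_simp⟩
  have hζ1 : ζ ≠ 1 := by
    rw [hζ, Ne, Complex.exp_eq_one_iff]
    rintro ⟨k, hk⟩
    have hpi : (2 * Real.pi * Complex.I : ℂ) ≠ 0 := Complex.two_pi_I_ne_zero
    rw [div_eq_iff hpc] at hk
    have h : (n : ℂ) = p * k := mul_left_cancel₀ hpi (by linear_combination hk)
    exact hn ⟨k, by exact_mod_cast h⟩
  have hterm (s : ℕ) : Complex.exp (Complex.I * n * ((t + 2 * Real.pi * s) / p : ℝ)) =
      Complex.exp (Complex.I * n * t / p) * ζ ^ s := by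
    rw [hζ, ← Complex.exp_nat_mul, ← Complex.exp_add]
    push_cast
    ring_nf
  simp_rw [hterm]
  rw [← Finset.mul_sum, ← Finset.Ico_succ_right_eq_Icc, Finset.sum_Ico_eq_sum_range]
  simp [pow_add, ← Finset.mul_sum, geom_sum_eq hζ1, hζp]

/-- On multiples of `p` the `p` points `(t + 2πs) / p` all give the same value. -/
theorem exp_natCast_mul_div {p : ℕ} (hp : p ≠ 0) (t : ℝ) (j : ℤ) (s : ℕ) :
    Complex.exp (Complex.I * ((p * j : ℤ) : ℂ) * ((t + 2 * Real.pi * s) / p : ℝ)) =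
      Complex.exp (Complex.I * j * t) := by
  have hpc : (p : ℂ) ≠ 0 := by exact_mod_cast hp
  rw [Complex.exp_eq_exp_iff_exists_int]
  refine ⟨j * s, ?_⟩
  push_cast
  field_simp

/-- Extraction of the multiples of `p` from the Jacobi–Anger expansion. -/
theorem hasSum_besselIN_mul_natAbs {p : ℕ} (hp : p ≠ 0) (R t : ℝ) :
    HasSum (fun j : ℤ =>
        (besselIN (p * j.natAbs) R : ℂ) * Complex.exp (Complex.I * (j : ℂ) * (t : ℂ)))
      (((1 / (p : ℝ)) * ∑ s ∈ Finset.Icc 1 p,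
        Real.exp (R * Real.cos ((t + 2 * Real.pi * (s : ℝ)) / (p : ℝ))) : ℝ) : ℂ) := by
  have hpc : (p : ℂ) ≠ 0 := by exact_mod_cast hp
  have hpz : (p : ℤ) ≠ 0 := by exact_mod_cast hp
  have hsum := (hasSum_sum fun s (_ : s ∈ Finset.Icc 1 p) =>
    hasSum_besselIN_mul_exp R ((t + 2 * Real.pi * s) / p)).mul_left (1 / (p : ℂ))
  rw [← (mul_right_injective₀ hpz).hasSum_iff] at hsum
  · convert! hsum using 1
    · ext j
      simp only [Function.comp_apply, exp_natCast_mul_div hp, Int.natAbs_mul, Int.natAbs_natCast,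
        Finset.sum_const, Nat.card_Icc, nsmul_eq_mul, Nat.add_sub_cancel]
      field_simp
    · push_cast
      rfl
  · intro n hn
    have hdvd : ¬ (p : ℤ) ∣ n := fun ⟨k, hk⟩ => hn ⟨k, hk.symm⟩
    rw [← Finset.mul_sum, sum_exp_eq_zero_of_not_dvd hp t hdvd, mul_zero, mul_zero]

theorem stmt4 (p : ℕ) (hp : 1 ≤ p) (R : ℝ) (hR : 0 ≤ R) (t : ℝ) :
    Summable (fun j : ℤ =>
      (besselIN (p * j.natAbs) R : ℂ) * Complex.exp (Complex.I * (j : ℂ) * (t : ℂ))) ∧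
    ∑' j : ℤ, (besselIN (p * j.natAbs) R : ℂ) * Complex.exp (Complex.I * (j : ℂ) * (t : ℂ)) =
      (((1 / (p : ℝ)) * ∑ s ∈ Finset.Icc 1 p,
        Real.exp (R * Real.cos ((t + 2 * Real.pi * (s : ℝ)) / (p : ℝ))) : ℝ) : ℂ) := by
  have h := hasSum_besselIN_mul_natAbs (Nat.one_le_iff_ne_zero.mp hp) R t
  exact ⟨h.summable, h.tsum_eq⟩
end

section
/- Let p ≥ 1 and ν ≥ 1 be integers and R > 0, and set g(ζ) = Σ_{j=0}^∞ (j+ν) I_{p(j+ν)}(R) C_j^ν(cos ζ). Then there exists a real polynomial Q of degree at most ν−1 such that for all t ∈ [0,π]: ∫_t^π g(ζ) sin ζ (cos t − cos ζ)^{ν−1} dζ = (1/(2^ν p)) Σ_{s=1}^p exp( R cos((t+2πs)/p) ) + Q(cos t). -/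
/-- Modified Bessel function of the first kind of real order `α ≥ 0`. -/
noncomputable def besselI (α R : ℝ) : ℝ :=
  ∑' m : ℕ, (R / 2) ^ (2 * (m : ℝ) + α) / (Nat.factorial m * Real.Gamma ((m : ℝ) + α + 1))

/-- Gegenbauer polynomial `C_j^ν(x)` for real `ν > 0`. -/
noncomputable def gegenbauerC (ν : ℝ) (j : ℕ) (x : ℝ) : ℝ :=
  ∑ k ∈ Finset.range (j / 2 + 1),
    (-1 : ℝ) ^ k * Real.Gamma (ν + (j : ℝ) - (k : ℝ)) /
      (Real.Gamma ν * Nat.factorial k * Nat.factorial (j - 2 * k)) * (2 * x) ^ (j - 2 * k)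

theorem besselI_natCast (n : ℕ) (R : ℝ) :
    besselI n R = ∑' m : ℕ, (R / 2) ^ (2 * m + n) / (m.factorial * (m + n).factorial : ℝ) := by
  unfold besselI
  congr 1 with m
  have h1 : (2 * (m : ℝ) + n) = ((2 * m + n : ℕ) : ℝ) := by push_cast; ring
  have h2 : Real.Gamma ((m : ℝ) + n + 1) = (m + n).factorial := by
    rw [← Real.Gamma_nat_eq_factorial]; push_cast; ring_nf
  rw [h1, h2, Real.rpow_natCast]

theorem besselI_term_le (n m : ℕ) {R : ℝ} (hR : 0 ≤ R) :
    (R / 2) ^ (2 * m + n) / (m.factorial * (m + n).factorial : ℝ) ≤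
      (R / 2) ^ n / n.factorial * (((R / 2) ^ 2) ^ m / m.factorial) := by
  rw [div_mul_div_comm, pow_add, pow_mul, mul_comm ((R / 2) ^ n), mul_comm (n.factorial : ℝ)]
  gcongr
  omega

theorem summable_besselI_term (n : ℕ) {R : ℝ} (hR : 0 ≤ R) :
    Summable fun m : ℕ => (R / 2) ^ (2 * m + n) / (m.factorial * (m + n).factorial : ℝ) :=
  .of_nonneg_of_le (fun m => by positivity) (fun m => besselI_term_le n m hR)
    ((Real.summable_pow_div_factorial _).mul_left _)

theorem besselI_natCast_nonneg (n : ℕ) {R : ℝ} (hR : 0 ≤ R) : 0 ≤ besselI n R := by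
  rw [besselI_natCast]
  exact tsum_nonneg fun m => by positivity

theorem besselI_natCast_le (n : ℕ) {R : ℝ} (hR : 0 ≤ R) :
    besselI n R ≤ (R / 2) ^ n / n.factorial * Real.exp ((R / 2) ^ 2) := by
  rw [besselI_natCast, Real.exp_eq_exp_ℝ, NormedSpace.exp_eq_tsum_div, ← tsum_mul_left]
  exact (summable_besselI_term n hR).tsum_le_tsum (fun m => besselI_term_le n m hR)
    ((Real.summable_pow_div_factorial _).mul_left _)

theorem summable_besselI_mul_pow {p : ℕ} (hp : 1 ≤ p) {R : ℝ} (hR : 0 ≤ R) (c : ℝ) (hc : 0 ≤ c) :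
    Summable fun n : ℕ => besselI (p * n : ℕ) R * c ^ n := by
  refine .of_nonneg_of_le (fun n => mul_nonneg (besselI_natCast_nonneg _ hR) (by positivity))
    (fun n => ?_) ((Real.summable_pow_div_factorial ((R / 2) ^ p * c)).mul_right
      (Real.exp ((R / 2) ^ 2)))
  calc besselI (p * n : ℕ) R * c ^ n
      ≤ (R / 2) ^ (p * n) / (p * n).factorial * Real.exp ((R / 2) ^ 2) * c ^ n := by
        gcongr; exact besselI_natCast_le _ hR
    _ ≤ (R / 2) ^ (p * n) / n.factorial * Real.exp ((R / 2) ^ 2) * c ^ n := by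
        gcongr; nlinarith
    _ = _ := by rw [mul_pow, ← pow_mul]; ring

/-- The equivalence `(a, b) ↦ (a - b, min a b)`. -/
def natProdEquivSubMin : ℕ × ℕ ≃ ℤ × ℕ where
  toFun a := (a.1 - a.2, min a.1 a.2)
  invFun a := (a.2 + a.1.toNat, a.2 + (-a.1).toNat)
  left_inv a := by ext <;> simp <;> omega
  right_inv a := by ext <;> simp; omega

open Complex in
theorem pow_div_factorial_mul_natProdEquivSubMin_symm (R θ : ℝ) (n : ℤ) (m : ℕ) :
    (R / 2 * cexp (θ * I)) ^ (natProdEquivSubMin.symm (n, m)).1 /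
        ((natProdEquivSubMin.symm (n, m)).1.factorial : ℂ) *
      ((R / 2 * cexp (-θ * I)) ^ (natProdEquivSubMin.symm (n, m)).2 /
        ((natProdEquivSubMin.symm (n, m)).2.factorial : ℂ)) =
    (((R / 2) ^ (2 * m + n.natAbs) / (m.factorial * (m + n.natAbs).factorial : ℝ) : ℝ) : ℂ) *
      cexp (n * θ * I) := by
  set z : ℂ := R / 2 * cexp (θ * I) with hz
  set w : ℂ := R / 2 * cexp (-θ * I) with hw
  have hzw : z * w = (R / 2) ^ 2 := by
    simp only [hz, hw]
    rw [mul_mul_mul_comm, ← Complex.exp_add]; simp [sq]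
  obtain ⟨k, rfl | rfl⟩ := n.eq_nat_or_neg
  · simp only [natProdEquivSubMin, Equiv.coe_fn_symm_mk, Int.toNat_natCast,
      Int.toNat_neg_natCast, add_zero, Int.natAbs_natCast]
    have hexp : cexp ((k : ℤ) * θ * I) = cexp (θ * I) ^ k := by
      rw [← Complex.exp_nat_mul]; push_cast; ring_nf
    have hpow : z ^ (m + k) * w ^ m = ((R / 2) ^ (2 * m + k)) * cexp (θ * I) ^ k := by
      rw [pow_add, mul_right_comm, ← mul_pow, hzw, hz, mul_pow, pow_add, pow_mul]; ring
    rw [hexp, div_mul_div_comm, hpow]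
    push_cast
    ring
  · simp only [natProdEquivSubMin, Equiv.coe_fn_symm_mk, Int.toNat_natCast, neg_neg,
      Int.toNat_neg_natCast, add_zero, Int.natAbs_neg, Int.natAbs_natCast]
    have hexp : cexp ((-(k : ℤ) : ℤ) * θ * I) = cexp (-θ * I) ^ k := by
      rw [← Complex.exp_nat_mul]; push_cast; ring_nf
    have hpow : z ^ m * w ^ (m + k) = ((R / 2) ^ (2 * m + k)) * cexp (-θ * I) ^ k := by
      rw [pow_add, ← mul_assoc, ← mul_pow, hzw, hw, mul_pow, pow_add, pow_mul]; ring
    rw [hexp, div_mul_div_comm, hpow]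
    push_cast
    ring

theorem hasSum_pow_div_factorial_mul (z w : ℂ) :
    HasSum (fun q : ℕ × ℕ => z ^ q.1 / (q.1.factorial : ℂ) * (w ^ q.2 / (q.2.factorial : ℂ)))
      (Complex.exp z * Complex.exp w) := by
  have hexp : ∀ z : ℂ, HasSum (fun a : ℕ => z ^ a / (a.factorial : ℂ)) (Complex.exp z) :=
    fun z => by
      rw [Complex.exp_eq_exp_ℂ]; exact NormedSpace.expSeries_div_hasSum_exp z
  have hsum := summable_mul_of_summable_norm (NormedSpace.norm_expSeries_div_summable z)
    (NormedSpace.norm_expSeries_div_summable w)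
  have h := (hexp z).mul (hexp w) hsum
  exact h

open Complex in
theorem hasSum_besselI_mul_cexp {R : ℝ} (hR : 0 ≤ R) (θ : ℝ) :
    HasSum (fun n : ℤ => (besselI n.natAbs R : ℂ) * cexp (n * θ * I))
      (cexp (R * Real.cos θ)) := by
  have h := hasSum_pow_div_factorial_mul (R / 2 * cexp (θ * I)) (R / 2 * cexp (-θ * I))
  have hval : cexp (R / 2 * cexp (θ * I)) * cexp (R / 2 * cexp (-θ * I)) =
      cexp (R * Real.cos θ) := by
    rw [← Complex.exp_add, Complex.ofReal_cos, Complex.cos]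
    congr 1
    ring
  rw [hval] at h
  replace h := (Equiv.hasSum_iff natProdEquivSubMin.symm).mpr h
  refine HasSum.prod_fiberwise h fun n => ?_
  have hI : HasSum (fun m : ℕ => (R / 2) ^ (2 * m + n.natAbs) /
      (m.factorial * (m + n.natAbs).factorial : ℝ)) (besselI n.natAbs R) := by
    rw [besselI_natCast]; exact (summable_besselI_term _ hR).hasSum
  refine ((Complex.hasSum_ofReal.mpr hI).mul_right (cexp (n * θ * I))).congr_fun ?_
  intro m
  exact pow_div_factorial_mul_natProdEquivSubMin_symm R θ n m

open Complex in
theorem sum_cexp_two_pi_mul {p : ℕ} (hp : 1 ≤ p) (n : ℤ) :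
    ∑ s ∈ Finset.Icc 1 p, cexp (n * (2 * Real.pi * s / p) * I) =
      if (p : ℤ) ∣ n then (p : ℂ) else 0 := by
  have hp0 : p ≠ 0 := by omega
  have hpc : (p : ℂ) ≠ 0 := by exact_mod_cast hp0
  have hζ := Complex.isPrimitiveRoot_exp p hp0
  set ζ := cexp (2 * Real.pi * I / p)
  have hterm : ∀ s : ℕ, cexp (n * (2 * Real.pi * s / p) * I) = (ζ ^ n) ^ s := fun s => by
    rw [← Complex.exp_int_mul, ← Complex.exp_nat_mul]; congr 1; ring
  simp_rw [hterm]
  have hpow : (ζ ^ n) ^ p = 1 := by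
    rw [← zpow_natCast, ← zpow_mul, mul_comm, zpow_mul, zpow_natCast, hζ.pow_eq_one, one_zpow]
  split_ifs with h
  · simp [(hζ.zpow_eq_one_iff_dvd n).mpr h]
  · have hne : ζ ^ n - 1 ≠ 0 := sub_ne_zero.mpr fun h' => h ((hζ.zpow_eq_one_iff_dvd n).mp h')
    have hg := mul_geom_sum (ζ ^ n) p
    rw [hpow, sub_self] at hg
    have hg0 := (mul_eq_zero.mp hg).resolve_left hne
    have hI : Finset.Icc 1 p = Finset.Ico 1 (p + 1) := by ext; simp
    rw [hI, Finset.sum_Ico_eq_sum_range, Nat.add_sub_cancel]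
    simp_rw [pow_add]
    rw [← Finset.mul_sum, hg0, mul_zero]

open Complex in
theorem hasSum_besselI_mul_cos {p : ℕ} (hp : 1 ≤ p) {R : ℝ} (hR : 0 ≤ R) (t : ℝ) :
    HasSum (fun n : ℕ => besselI (p * n : ℕ) R * Real.cos (n * t))
      ((1 / (2 * p)) * ∑ s ∈ Finset.Icc 1 p,
        Real.exp (R * Real.cos ((t + 2 * Real.pi * s) / p)) + besselI 0 R / 2) := by
  have hp0 : (p : ℝ) ≠ 0 := by positivity
  have hpc : (p : ℂ) ≠ 0 := by exact_mod_cast hp0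
  have hpz : (p : ℤ) ≠ 0 := by positivity
  have h := hasSum_sum (s := Finset.Icc 1 p) fun s _ =>
    hasSum_besselI_mul_cexp hR ((t + 2 * Real.pi * s) / p)
  have hterm : ∀ n : ℤ, ∑ s ∈ Finset.Icc 1 p, (besselI n.natAbs R : ℂ) *
      cexp (n * ((t + 2 * Real.pi * s) / p : ℝ) * I) =
      besselI n.natAbs R * cexp (n * (t / p) * I) * if (p : ℤ) ∣ n then (p : ℂ) else 0 := fun n => by
    rw [← sum_cexp_two_pi_mul hp, Finset.mul_sum]
    refine Finset.sum_congr rfl fun s _ => ?_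
    rw [mul_assoc (besselI n.natAbs R : ℂ), ← Complex.exp_add]; push_cast; congr 2; ring
  simp_rw [hterm] at h
  have hinj : Function.Injective fun n : ℤ => (p : ℤ) * n := mul_right_injective₀ hpz
  rw [← hinj.hasSum_iff] at h
  swap
  · intro n hn
    rw [if_neg, mul_zero]
    rintro ⟨k, rfl⟩
    exact hn ⟨k, rfl⟩
  have h2 := h.nat_add_neg
  rw [← Complex.hasSum_ofReal]
  convert! h2.mul_left (1 / (2 * p : ℂ)) using 1
  · ext n
    simp only [Function.comp, dvd_mul_right, dvd_neg, if_true, mul_neg, Int.natAbs_neg,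
      Int.natAbs_mul, Int.natAbs_natCast]
    push_cast
    have h3 : (p : ℂ) * n * (t / p) * I = n * t * I := by field_simp
    have h4 : -((p : ℂ) * n) * (t / p) * I = -(n * t) * I := by field_simp
    rw [h3, h4, Complex.cos]
    field_simp
  · simp
    field_simp

theorem gegenbauerC_natCast (k j : ℕ) (x : ℝ) :
    gegenbauerC (k + 1 : ℕ) j x = ∑ i ∈ Finset.range (j / 2 + 1),
      (-1 : ℝ) ^ i * ((k + (j - i)).choose k * (j - i).choose i : ℕ) * (2 * x) ^ (j - 2 * i) := by
  unfold gegenbauerC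
  refine Finset.sum_congr rfl fun i hi => ?_
  have hi : 2 * i ≤ j := by have := Finset.mem_range.mp hi; omega
  have h1 : Real.Gamma ((k + 1 : ℕ) + j - i) = (k + (j - i)).factorial := by
    rw [← Real.Gamma_nat_eq_factorial]
    push_cast [Nat.cast_sub (by omega : i ≤ j)]; ring_nf
  have h2 : Real.Gamma (k + 1 : ℕ) = k.factorial := by
    rw [← Real.Gamma_nat_eq_factorial]; push_cast; rfl
  rw [h1, h2]
  have h3 := Nat.choose_mul_factorial_mul_factorial (Nat.le_add_right k (j - i))
  rw [Nat.add_sub_cancel_left] at h3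
  have h4 := Nat.choose_mul_factorial_mul_factorial (by omega : i ≤ j - i)
  rw [show j - i - i = j - 2 * i by omega] at h4
  congr 1
  rw [mul_div_assoc]
  congr 1
  rw [div_eq_iff (by positivity), ← h3, ← h4]
  push_cast; ring

theorem hasDerivAt_gegenbauerC_zero (ν x : ℝ) : HasDerivAt (gegenbauerC ν 0) 0 x := by
  have : gegenbauerC ν 0 = fun _ => Real.Gamma ν / Real.Gamma ν := by
    ext y; simp [gegenbauerC]
  rw [this]
  exact hasDerivAt_const _ _

theorem hasDerivAt_gegenbauerC_succ {ν : ℝ} (hν : 0 < ν) (j : ℕ) (x : ℝ) :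
    HasDerivAt (gegenbauerC ν (j + 1)) (2 * ν * gegenbauerC (ν + 1) j x) x := by
  unfold gegenbauerC
  have h : ∀ i ∈ Finset.range ((j + 1) / 2 + 1), HasDerivAt (fun y : ℝ =>
      (-1 : ℝ) ^ i * Real.Gamma (ν + ((j + 1 : ℕ) : ℝ) - i) /
        (Real.Gamma ν * i.factorial * (j + 1 - 2 * i).factorial) * (2 * y) ^ (j + 1 - 2 * i))
      ((-1 : ℝ) ^ i * Real.Gamma (ν + ((j + 1 : ℕ) : ℝ) - i) /
        (Real.Gamma ν * i.factorial * (j + 1 - 2 * i).factorial) *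
        ((j + 1 - 2 * i : ℕ) * (2 * x) ^ (j + 1 - 2 * i - 1) * 2)) x := fun i _ => by
    simpa using ((((hasDerivAt_id x).const_mul 2).pow (j + 1 - 2 * i)).const_mul _)
  refine (HasDerivAt.fun_sum h).congr_deriv ?_
  rw [Finset.mul_sum]
  symm
  refine Finset.sum_subset_zero_on_sdiff (Finset.range_mono (by omega)) ?_ ?_
  · intro i hi
    simp only [Finset.mem_sdiff, Finset.mem_range] at hi
    have : j + 1 - 2 * i = 0 := by omega
    simp [this]
  · intro i hi
    have hi : 2 * i ≤ j := by have := Finset.mem_range.mp hi; omega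
    have h1 : j + 1 - 2 * i = (j - 2 * i) + 1 := by omega
    rw [h1, Nat.factorial_succ, Real.Gamma_add_one hν.ne', Nat.add_sub_cancel,
      show ν + 1 + (j : ℝ) - i = ν + ((j + 1 : ℕ) : ℝ) - i by push_cast; ring]
    have := (Real.Gamma_pos_of_pos hν).ne'
    have h5 : ((j - 2 * i + 1 : ℕ) : ℝ) ≠ 0 := by positivity
    push_cast at h5 ⊢
    field_simp

theorem abs_gegenbauerC_natCast_le (k j : ℕ) {x : ℝ} (hx : |x| ≤ 1) :
    |gegenbauerC (k + 1 : ℕ) j x| ≤ 16 ^ (k + j) := by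
  rw [gegenbauerC_natCast]
  calc _ ≤ ∑ i ∈ Finset.range (j / 2 + 1), (2 : ℝ) ^ (k + 3 * j) := by
        refine (Finset.abs_sum_le_sum_abs _ _).trans (Finset.sum_le_sum fun i _ => ?_)
        rw [abs_mul, abs_mul, abs_pow, abs_pow, abs_neg, abs_one, one_pow, one_mul, abs_mul,
          Nat.abs_cast, abs_two]
        have h1 : (((k + (j - i)).choose k * (j - i).choose i : ℕ) : ℝ) ≤ 2 ^ (k + j) * 2 ^ j := by
          have h2 : (k + (j - i)).choose k ≤ 2 ^ (k + j) :=
            (Nat.choose_le_two_pow _ _).trans (Nat.pow_le_pow_right (by norm_num) (by omega))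
          have h3 : (j - i).choose i ≤ 2 ^ j :=
            (Nat.choose_le_two_pow _ _).trans (Nat.pow_le_pow_right (by norm_num) (by omega))
          exact_mod_cast Nat.mul_le_mul h2 h3
        have h4 : (2 * |x|) ^ (j - 2 * i) ≤ 2 ^ j :=
          (pow_le_pow_left₀ (by positivity) (by linarith) _).trans
            (pow_le_pow_right₀ (by norm_num) (by omega))
        calc _ ≤ (2 : ℝ) ^ (k + j) * 2 ^ j * 2 ^ j := by gcongr
          _ = _ := by ring
    _ = (j / 2 + 1 : ℕ) * (2 : ℝ) ^ (k + 3 * j) := by simp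
    _ ≤ 2 ^ j * (2 : ℝ) ^ (k + 3 * j) := by
        gcongr
        have : j / 2 + 1 ≤ 2 ^ j := (by omega : j / 2 + 1 ≤ j + 1).trans (Nat.lt_two_pow_self)
        exact_mod_cast this
    _ = 2 ^ k * 16 ^ j := by rw [show (16 : ℝ) = 2 ^ 4 by norm_num, ← pow_mul]; ring
    _ ≤ 16 ^ k * 16 ^ j := by gcongr; norm_num
    _ = _ := by ring

theorem sum_antidiagonal_eq_U_eval (x : ℝ) : ∀ j : ℕ,
    ∑ q ∈ Finset.HasAntidiagonal.antidiagonal j,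
        (-1 : ℝ) ^ q.2 * (q.1.choose q.2 : ℕ) * (2 * x) ^ (q.1 - q.2) =
      (Polynomial.Chebyshev.U ℝ j).eval x :=
  Nat.twoStepInduction (by simp) (by simp [Finset.Nat.antidiagonal_succ]) fun n h1 h2 => by
    push_cast at h2 ⊢
    rw [Polynomial.Chebyshev.U_add_two, Polynomial.eval_sub, Polynomial.eval_mul, ← h1, ← h2,
      Finset.Nat.antidiagonal_succ_succ', Finset.Nat.antidiagonal_succ']
    have key : ∀ a b : ℕ, ((a + 1).choose (b + 1) : ℝ) * (2 * x) ^ (a - b) =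
        (a.choose b : ℝ) * (2 * x) ^ (a - b) +
          2 * x * ((a.choose (b + 1) : ℝ) * (2 * x) ^ (a - (b + 1))) := fun a b => by
      rcases lt_or_ge b a with h | h
      · rw [Nat.choose_succ_succ, show a - b = (a - (b + 1)) + 1 by omega]; push_cast; ring
      · rw [Nat.choose_succ_succ, Nat.choose_eq_zero_of_lt (show a < b + 1 by omega)]; simp
    simp [mul_assoc, key, pow_succ, mul_add, Finset.sum_add_distrib, Finset.mul_sum]
    have hcomm : ∀ a b : ℕ, 2 * (x * ((-1) ^ b * (((a.choose (b + 1) : ℕ) : ℝ) *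
        (2 * x) ^ (a - (b + 1))))) =
        (-1) ^ b * (2 * (x * (((a.choose (b + 1) : ℕ) : ℝ) * (2 * x) ^ (a - (b + 1))))) :=
      fun a b => by ring
    simp only [hcomm]
    ring

theorem gegenbauerC_one (j : ℕ) (x : ℝ) :
    gegenbauerC 1 j x = (Polynomial.Chebyshev.U ℝ j).eval x := by
  have h := gegenbauerC_natCast 0 j x
  rw [zero_add, Nat.cast_one] at h
  rw [h, ← sum_antidiagonal_eq_U_eval, ← Finset.Nat.sum_antidiagonal_swap,
    Finset.Nat.sum_antidiagonal_eq_sum_range_succ_mk]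
  refine Finset.sum_subset_zero_on_sdiff (Finset.range_mono (by omega)) ?_ ?_
  · intro i hi
    simp only [Finset.mem_sdiff, Finset.mem_range] at hi
    simp [Nat.choose_eq_zero_of_lt (show j - i < i by omega)]
  · intro i hi
    simp only [Nat.choose_zero_right, one_mul, Prod.fst_swap, Prod.snd_swap, Nat.sub_sub, two_mul]

/-- `shiftedGegenbauer k n = C_{n-k}^k`, and `0` for `n < k`. -/
noncomputable def shiftedGegenbauer (k n : ℕ) (x : ℝ) : ℝ :=
  if k ≤ n then gegenbauerC k (n - k) x else 0

theorem hasDerivAt_shiftedGegenbauer {k : ℕ} (hk : 1 ≤ k) (n : ℕ) (x : ℝ) :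
    HasDerivAt (shiftedGegenbauer k n) (2 * k * shiftedGegenbauer (k + 1) n x) x := by
  unfold shiftedGegenbauer
  rcases lt_trichotomy n k with h | rfl | h
  · simp [h.not_ge, show ¬ k + 1 ≤ n by omega, hasDerivAt_const]
  · simp [hasDerivAt_gegenbauerC_zero]
  · obtain ⟨j, rfl⟩ := Nat.exists_eq_add_of_lt h
    have := hasDerivAt_gegenbauerC_succ (show (0 : ℝ) < k by exact_mod_cast hk) j x
    simpa [add_assoc, Nat.add_sub_add_left, add_comm 1, show k + (j + 1) - (k + 1) = j by omega]
      using this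

theorem abs_shiftedGegenbauer_le {k : ℕ} (hk : 1 ≤ k) (n : ℕ) {x : ℝ} (hx : |x| ≤ 1) :
    |shiftedGegenbauer k n x| ≤ 16 ^ n := by
  unfold shiftedGegenbauer
  split_ifs with h
  · obtain ⟨k, rfl⟩ := Nat.exists_eq_add_of_le' hk
    exact (abs_gegenbauerC_natCast_le k _ hx).trans
      (pow_le_pow_right₀ (by norm_num) (by omega))
  · simp

theorem shiftedGegenbauer_one_cos_mul_sin (n : ℕ) (ζ : ℝ) :
    shiftedGegenbauer 1 n (Real.cos ζ) * Real.sin ζ = Real.sin (n * ζ) := by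
  rcases n with _ | n
  · simp [shiftedGegenbauer]
  · simp [shiftedGegenbauer, gegenbauerC_one]

/-- `∑ n, n I_{pn}(R) C_{n-k}^k(cos ζ)`. -/
noncomputable def besselGegenbauerSum (p : ℕ) (R : ℝ) (k : ℕ) (ζ : ℝ) : ℝ :=
  ∑' n : ℕ, n * besselI (p * n : ℕ) R * shiftedGegenbauer k n (Real.cos ζ)

theorem norm_besselGegenbauerSum_term_le (p : ℕ) {R : ℝ} (hR : 0 ≤ R)
    {k : ℕ} (hk : 1 ≤ k) (n : ℕ) (ζ : ℝ) :
    ‖n * besselI (p * n : ℕ) R * shiftedGegenbauer k n (Real.cos ζ)‖ ≤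
      besselI (p * n : ℕ) R * 32 ^ n := by
  have h0 := besselI_natCast_nonneg (p * n) hR
  have h1 := abs_shiftedGegenbauer_le hk n (Real.abs_cos_le_one ζ)
  have h2 : (n : ℝ) ≤ 2 ^ n := by exact_mod_cast Nat.lt_two_pow_self.le
  rw [Real.norm_eq_abs, abs_mul, abs_mul, Nat.abs_cast, abs_of_nonneg h0]
  calc _ ≤ 2 ^ n * besselI (p * n : ℕ) R * 16 ^ n := by gcongr
    _ = _ := by rw [show (32 : ℝ) = 2 * 16 by norm_num, mul_pow]; ring

theorem summable_besselGegenbauerSum {p : ℕ} {R : ℝ} (hp : 1 ≤ p) (hR : 0 ≤ R)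
    {k : ℕ} (hk : 1 ≤ k) (ζ : ℝ) :
    Summable fun n : ℕ => n * besselI (p * n : ℕ) R * shiftedGegenbauer k n (Real.cos ζ) :=
  .of_norm_bounded (summable_besselI_mul_pow hp hR 32 (by norm_num))
    fun n => norm_besselGegenbauerSum_term_le p hR hk n ζ

theorem hasDerivAt_besselGegenbauerSum {p : ℕ} {R : ℝ} (hp : 1 ≤ p) (hR : 0 ≤ R)
    {k : ℕ} (hk : 1 ≤ k) (ζ : ℝ) :
    HasDerivAt (besselGegenbauerSum p R k)
      (-(2 * k) * (besselGegenbauerSum p R (k + 1) ζ * Real.sin ζ)) ζ := by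
  unfold besselGegenbauerSum
  rw [← tsum_mul_right, ← tsum_mul_left]
  have hsum := (summable_besselI_mul_pow hp hR 32 (by norm_num)).mul_left (2 * k : ℝ)
  have h0 := summable_besselGegenbauerSum hp hR hk 0
  refine hasDerivAt_tsum
    (g := fun n ζ => n * besselI (p * n : ℕ) R * shiftedGegenbauer k n (Real.cos ζ))
    (g' := fun n ζ => -(2 * k) * (n * besselI (p * n : ℕ) R *
      shiftedGegenbauer (k + 1) n (Real.cos ζ) * Real.sin ζ))
    hsum (fun n y => ?_) (fun n y => ?_) h0 ζ
  · have := ((hasDerivAt_shiftedGegenbauer hk n (Real.cos y)).comp y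
      (Real.hasDerivAt_cos y)).const_mul (n * besselI (p * n : ℕ) R)
    refine this.congr_deriv ?_
    ring
  · have h1 := norm_besselGegenbauerSum_term_le p hR (Nat.le_add_left 1 k) n y
    rw [norm_mul, norm_mul _ (Real.sin y), norm_neg, Real.norm_of_nonneg (by positivity)]
    have h2 : ‖Real.sin y‖ ≤ 1 := Real.abs_sin_le_one y
    exact mul_le_mul_of_nonneg_left ((mul_le_of_le_one_right (norm_nonneg _) h2).trans h1)
      (by positivity)

theorem continuous_besselGegenbauerSum {p : ℕ} {R : ℝ} (hp : 1 ≤ p) (hR : 0 ≤ R)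
    {k : ℕ} (hk : 1 ≤ k) :
    Continuous (besselGegenbauerSum p R k) :=
  continuous_iff_continuousAt.mpr fun ζ => (hasDerivAt_besselGegenbauerSum hp hR hk ζ).continuousAt

theorem hasDerivAt_tsum_besselI_mul_cos {p : ℕ} {R : ℝ} (hp : 1 ≤ p) (hR : 0 ≤ R)
    (ζ : ℝ) :
    HasDerivAt (fun t => ∑' n : ℕ, besselI (p * n : ℕ) R * Real.cos (n * t))
      (-(besselGegenbauerSum p R 1 ζ * Real.sin ζ)) ζ := by
  unfold besselGegenbauerSum
  rw [← tsum_mul_right, ← tsum_neg]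
  have hsum := summable_besselI_mul_pow hp hR 32 (by norm_num)
  have h0 := (hasSum_besselI_mul_cos hp hR 0).summable
  refine hasDerivAt_tsum
    (g := fun n t => besselI (p * n : ℕ) R * Real.cos (n * t))
    (g' := fun n ζ => -(n * besselI (p * n : ℕ) R *
      shiftedGegenbauer 1 n (Real.cos ζ) * Real.sin ζ))
    hsum (fun n y => ?_) (fun n y => ?_) h0 ζ
  · have := (((hasDerivAt_id y).const_mul (n : ℝ)).cos).const_mul (besselI (p * n : ℕ) R)
    refine this.congr_deriv ?_
    rw [mul_assoc, shiftedGegenbauer_one_cos_mul_sin]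
    simp only [id]; ring
  · have h1 := norm_besselGegenbauerSum_term_le p hR le_rfl n y
    rw [norm_neg, norm_mul _ (Real.sin y)]
    exact (mul_le_of_le_one_right (norm_nonneg _) (Real.abs_sin_le_one y)).trans h1

theorem integral_besselGegenbauerSum_one {p : ℕ} {R : ℝ} (hp : 1 ≤ p) (hR : 0 ≤ R)
    (t : ℝ) :
    ∫ ζ in t..Real.pi, besselGegenbauerSum p R 1 ζ * Real.sin ζ =
      (∑' n : ℕ, besselI (p * n : ℕ) R * Real.cos (n * t)) -
        ∑' n : ℕ, besselI (p * n : ℕ) R * Real.cos (n * Real.pi) := by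
  have hc := continuous_besselGegenbauerSum hp hR le_rfl
  have h := intervalIntegral.integral_eq_sub_of_hasDerivAt
    (fun ζ _ => hasDerivAt_tsum_besselI_mul_cos hp hR ζ)
    (a := t) (b := Real.pi) (Continuous.intervalIntegrable (by fun_prop) _ _)
  rw [intervalIntegral.integral_neg] at h
  linarith

theorem integral_besselGegenbauerSum_succ {p : ℕ} {R : ℝ} (hp : 1 ≤ p) (hR : 0 ≤ R)
    {k : ℕ} (hk : 1 ≤ k) (t : ℝ) :
    ∫ ζ in t..Real.pi, besselGegenbauerSum p R (k + 1) ζ * Real.sin ζ *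
        (Real.cos t - Real.cos ζ) ^ k =
      1 / 2 * (∫ ζ in t..Real.pi, besselGegenbauerSum p R k ζ * Real.sin ζ *
        (Real.cos t - Real.cos ζ) ^ (k - 1)) -
      besselGegenbauerSum p R k Real.pi / (2 * k) * (Real.cos t + 1) ^ k := by
  have hk0 : (k : ℝ) ≠ 0 := by positivity
  have hc := continuous_besselGegenbauerSum hp hR hk
  have hc' := continuous_besselGegenbauerSum hp hR (Nat.le_add_left 1 k)
  have hu : ∀ ζ : ℝ, HasDerivAt (fun ζ => (Real.cos t - Real.cos ζ) ^ k)
      (k * (Real.cos t - Real.cos ζ) ^ (k - 1) * Real.sin ζ) ζ := fun ζ => by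
    simpa using ((Real.hasDerivAt_cos ζ).const_sub (Real.cos t)).fun_pow k
  have hv : ∀ ζ : ℝ, HasDerivAt (fun ζ => -besselGegenbauerSum p R k ζ / (2 * k))
      (besselGegenbauerSum p R (k + 1) ζ * Real.sin ζ) ζ := fun ζ => by
    refine ((hasDerivAt_besselGegenbauerSum hp hR hk ζ).neg.div_const (2 * k : ℝ)).congr_deriv ?_
    field_simp
  have h := intervalIntegral.integral_mul_deriv_eq_deriv_mul (a := t) (b := Real.pi)
    (fun ζ _ => hu ζ) (fun ζ _ => hv ζ)
    (Continuous.intervalIntegrable (by fun_prop) _ _)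
    (Continuous.intervalIntegrable (by fun_prop) _ _)
  have h1 : ∀ ζ, k * (Real.cos t - Real.cos ζ) ^ (k - 1) * Real.sin ζ *
      (-besselGegenbauerSum p R k ζ / (2 * k)) = -(1 / 2) * (besselGegenbauerSum p R k ζ *
        Real.sin ζ * (Real.cos t - Real.cos ζ) ^ (k - 1)) := fun ζ => by field_simp
  simp_rw [h1] at h
  rw [intervalIntegral.integral_const_mul, sub_self, zero_pow (by omega), Real.cos_pi] at h
  simp_rw [mul_comm _ ((Real.cos t - Real.cos _) ^ k)]
  rw [h]
  ring

theorem exists_polynomial_integral_besselGegenbauerSum {p : ℕ} {R : ℝ} (hp : 1 ≤ p) (hR : 0 ≤ R)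
    (k : ℕ) :
    ∃ Q : Polynomial ℝ, Q.natDegree ≤ k ∧ ∀ t : ℝ,
      ∫ ζ in t..Real.pi, besselGegenbauerSum p R (k + 1) ζ * Real.sin ζ *
          (Real.cos t - Real.cos ζ) ^ k =
        (1 / (2 ^ (k + 1) * (p : ℝ))) * ∑ s ∈ Finset.Icc 1 p,
          Real.exp (R * Real.cos ((t + 2 * Real.pi * (s : ℝ)) / (p : ℝ))) +
        Q.eval (Real.cos t) := by
  induction k with
  | zero =>
    refine ⟨Polynomial.C (besselI 0 R / 2 -
      ∑' n : ℕ, besselI (p * n : ℕ) R * Real.cos (n * Real.pi)), by simp, fun t => ?_⟩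
    simp only [pow_zero, mul_one, zero_add, pow_one, Polynomial.eval_C]
    rw [integral_besselGegenbauerSum_one hp hR, (hasSum_besselI_mul_cos hp hR t).tsum_eq]
    ring
  | succ k ih =>
    obtain ⟨Q, hQ, h⟩ := ih
    refine ⟨Polynomial.C (1 / 2) * Q - Polynomial.C (besselGegenbauerSum p R (k + 1) Real.pi /
      (2 * (k + 1 : ℕ))) * (Polynomial.X + Polynomial.C 1) ^ (k + 1), ?_, fun t => ?_⟩
    · refine (Polynomial.natDegree_sub_le _ _).trans (max_le ?_ ?_)
      · exact (Polynomial.natDegree_C_mul_le _ _).trans (by omega)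
      · refine (Polynomial.natDegree_C_mul_le _ _).trans ?_
        rw [Polynomial.natDegree_pow, Polynomial.natDegree_X_add_C, mul_one]
    · rw [integral_besselGegenbauerSum_succ hp hR (Nat.le_add_left 1 k), Nat.add_sub_cancel, h]
      simp only [Polynomial.eval_sub, Polynomial.eval_mul, Polynomial.eval_C, Polynomial.eval_pow,
        Polynomial.eval_add, Polynomial.eval_X]
      rw [pow_succ 2 (k + 1)]
      field_simp
      ring

theorem besselGegenbauerSum_eq {p : ℕ} {R : ℝ} (hp : 1 ≤ p) (hR : 0 ≤ R)
    {k : ℕ} (hk : 1 ≤ k) (ζ : ℝ) :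
    besselGegenbauerSum p R k ζ = ∑' j : ℕ, ((j : ℝ) + (k : ℝ)) *
      besselI ((p : ℝ) * ((j : ℝ) + (k : ℝ))) R * gegenbauerC (k : ℝ) j (Real.cos ζ) := by
  unfold besselGegenbauerSum
  rw [← (summable_besselGegenbauerSum hp hR hk ζ).sum_add_tsum_nat_add k,
    Finset.sum_eq_zero, zero_add]
  · simp [shiftedGegenbauer]
  · intro n hn
    simp [shiftedGegenbauer, Finset.mem_range.mp hn]

theorem stmt9 (p ν : ℕ) (hp : 1 ≤ p) (hν : 1 ≤ ν) (R : ℝ) (hR : 0 < R)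
    (g : ℝ → ℝ)
    (hg : ∀ ζ, g ζ = ∑' j : ℕ, ((j : ℝ) + (ν : ℝ)) *
      besselI ((p : ℝ) * ((j : ℝ) + (ν : ℝ))) R * gegenbauerC (ν : ℝ) j (Real.cos ζ)) :
    ∃ Q : Polynomial ℝ, Q.natDegree ≤ ν - 1 ∧
      ∀ t ∈ Set.Icc (0 : ℝ) Real.pi,
        ∫ ζ in t..Real.pi, g ζ * Real.sin ζ * (Real.cos t - Real.cos ζ) ^ (ν - 1) =
          (1 / (2 ^ ν * (p : ℝ))) * ∑ s ∈ Finset.Icc 1 p,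
            Real.exp (R * Real.cos ((t + 2 * Real.pi * (s : ℝ)) / (p : ℝ))) +
          Q.eval (Real.cos t) := by
  obtain ⟨k, rfl⟩ := Nat.exists_eq_add_of_le' hν
  obtain ⟨Q, hQ, h⟩ := exists_polynomial_integral_besselGegenbauerSum hp hR.le k
  have hgk : g = besselGegenbauerSum p R (k + 1) := by
    ext ζ
    rw [hg, besselGegenbauerSum_eq hp hR.le hν]
  exact ⟨Q, hQ, fun t _ => by rw [hgk]; exact h t⟩
end
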